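/- Converse for the AWGN model: suppose σ² > u_max²/2 and γ ∈ [0,1) satisfies γ < min{ C₀/(C₀ + σ²/(u_max·u_min)), C₁/(C₁+3), 1/2 }, where C₀ = (σ²/u_max²)(1 − u_max²/(2σ²)) and C₁ = (σ²/(2u_max²))(1 − u_max²/(2σ²))² + (u_max − u_min/2)²/(2σ²). Let (k_n), (N_n) be sequences of naturals with k_n → ∞, k_n < N_n, and (log k_n)/(log N_n) → γ. For each n let x be uniform on X_{k_n}^{N_n}(U), ω have i.i.d. N(0, σ²/log(N_n/k_n)) entries independent of x, and y = x + ω. Then for ANY sequence of measurable estimators x̂_n : ℝ^{N_n} → ℝ^{N_n}, liminf_{n→∞} (1/k_n)·E[‖x − x̂_n(y)‖₂²] ≥ (1/M)·∑_{m=1}^M u_m², i.e. liminf_{n→∞} (1/k_n)·( E[‖x − x̂_n(y)‖₂²] − E[‖x‖₂²] ) ≥ 0 (expectations taken in [0,∞]). -/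

import Mathlib

open MeasureTheory ProbabilityTheory Real Filter Finset
open scoped ENNReal NNReal Classical

/-- The finite set of vectors indexed by `ι` having exactly `w` nonzero entries,
each nonzero entry lying in the finite set `U`. -/
noncomputable def sparseVecs (U : Finset ℝ) (ι : Type) [Fintype ι] [DecidableEq ι]
    (w : ℕ) : Finset (ι → ℝ) :=
  (Fintype.piFinset fun _ : ι => insert (0 : ℝ) U).filter
    fun x => (Finset.univ.filter fun i => x i ≠ 0).card = w

/-- Uniform probability measure on a finite set. -/
noncomputable def uniformOn {α : Type*} [MeasurableSpace α] (S : Finset α) : Measure α :=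
  (S.card : ℝ≥0∞)⁻¹ • ∑ x ∈ S, Measure.dirac x
/-- Integrating a function over a finite product of probability measures may be done by first
resampling one coordinate. -/
lemma lintegral_pi_eq_lintegral_update {ι : Type*} [Fintype ι] [DecidableEq ι]
    {μ : ι → Measure ℝ} [∀ i, IsProbabilityMeasure (μ i)] {f : (ι → ℝ) → ℝ≥0∞}
    (hf : Measurable f) (i : ι) :
    ∫⁻ ω, f ω ∂Measure.pi μ =
      ∫⁻ ω, ∫⁻ t, f (Function.update ω i t) ∂μ i ∂Measure.pi μ := by
  have hg : Measurable fun ω => ∫⁻ t, f (Function.update ω i t) ∂μ i := by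
    have h : Measurable fun p : (ι → ℝ) × ℝ => f (Function.update p.1 i p.2) := by
      apply hf.comp
      rw [measurable_pi_iff]
      intro j
      rcases eq_or_ne j i with rfl | hj
      · simpa using measurable_snd
      · simp only [Function.update_of_ne hj]
        fun_prop
    exact h.lintegral_prod_right'
  refine lintegral_eq_of_lmarginal_eq {i} hf hg ?_
  ext x
  simp [lmarginal_singleton]

/-- The likelihood ratio between the Gaussian laws of variance `v` centred at `u` and at `0`. -/
noncomputable def gaussianTilt (v : ℝ≥0) (u t : ℝ) : ℝ := rexp ((u * t - u ^ 2 / 2) / v)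

lemma gaussianTilt_pos (v : ℝ≥0) (u t : ℝ) : 0 < gaussianTilt v u t := exp_pos _

@[fun_prop]
lemma measurable_gaussianTilt (v : ℝ≥0) (u : ℝ) : Measurable (gaussianTilt v u) := by
  unfold gaussianTilt
  fun_prop

lemma lintegral_const_add_gaussianReal {v : ℝ≥0} (hv : v ≠ 0) (u : ℝ) {f : ℝ → ℝ≥0∞}
    (hf : Measurable f) :
    ∫⁻ t, f (u + t) ∂gaussianReal 0 v =
      ∫⁻ t, f t * ENNReal.ofReal (gaussianTilt v u t) ∂gaussianReal 0 v := by
  have hmap := gaussianReal_map_const_add (μ := 0) (v := v) u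
  rw [← lintegral_map (f := f) (g := fun t => u + t) hf (by fun_prop), hmap, zero_add,
    gaussianReal_of_var_ne_zero _ hv, gaussianReal_of_var_ne_zero _ hv,
    lintegral_withDensity_eq_lintegral_mul _ (measurable_gaussianPDF _ _) hf,
    lintegral_withDensity_eq_lintegral_mul _ (measurable_gaussianPDF _ _) (by fun_prop)]
  refine lintegral_congr fun t => ?_
  have hv' : (v : ℝ) ≠ 0 := by exact_mod_cast hv
  have h : gaussianPDF u v t = gaussianPDF 0 v t * ENNReal.ofReal (gaussianTilt v u t) := by
    rw [gaussianPDF, gaussianPDF, ← ENNReal.ofReal_mul (gaussianPDFReal_nonneg _ _ _)]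
    congr 1
    simp only [gaussianPDFReal, gaussianTilt]
    rw [mul_assoc (√_)⁻¹, ← Real.exp_add]
    congr 2
    field_simp
    ring
  simp only [Pi.mul_apply, h]
  ring

/-- Removing the signal at coordinate `i` changes the law of the observation by the likelihood
ratio of that coordinate. -/
lemma lintegral_add_pi_gaussianReal {ι : Type*} [Fintype ι] [DecidableEq ι] {v : ℝ≥0}
    (hv : v ≠ 0) (x : ι → ℝ) (i : ι) {f : (ι → ℝ) → ℝ≥0∞} (hf : Measurable f) :
    ∫⁻ ω, f (x + ω) ∂Measure.pi (fun _ : ι => gaussianReal 0 v) =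
      ∫⁻ ω, f (Function.update x i 0 + ω) * ENNReal.ofReal (gaussianTilt v (x i) (ω i))
        ∂Measure.pi (fun _ : ι => gaussianReal 0 v) := by
  conv_lhs => rw [lintegral_pi_eq_lintegral_update (by fun_prop) i]
  conv_rhs => rw [lintegral_pi_eq_lintegral_update (by fun_prop) i]
  refine lintegral_congr fun ω => ?_
  have h₁ (t : ℝ) : x + Function.update ω i t = Function.update (x + ω) i (x i + t) := by
    ext j
    rcases eq_or_ne j i with rfl | hj <;> simp [*]
  have h₂ (t : ℝ) :
      Function.update x i 0 + Function.update ω i t = Function.update (x + ω) i t := by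
    ext j
    rcases eq_or_ne j i with rfl | hj <;> simp [*]
  simp only [h₁, h₂, Function.update_self]
  exact lintegral_const_add_gaussianReal hv (x i)
    (f := fun s => f (Function.update (x + ω) i s)) (hf.comp (measurable_update _))

/-- A lower-tail bound for sums of independent, identically distributed, bounded variables. -/
lemma measure_sum_pi_le {ι : Type*} [Fintype ι] [DecidableEq ι] {μ : Measure ℝ}
    [IsProbabilityMeasure μ] {ψ : ℝ → ℝ} (hψ : Measurable ψ) {K : ℝ} (h0 : ∀ t, 0 ≤ ψ t)
    (hK : ∀ t, ψ t ≤ K) (hm : ∫ t, ψ t ∂μ ≤ 1) (S : Finset ι) {r : ℝ} (hr : 0 < r) :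
    Measure.pi (fun _ : ι => μ) {ω | ∑ j ∈ S, ψ (ω j) ≤ #S * ∫ t, ψ t ∂μ - r} ≤
      ENNReal.ofReal (#S * K / r ^ 2) := by
  have hK0 : 0 ≤ K := (h0 0).trans (hK 0)
  have hLp : MemLp ψ 2 μ := MemLp.of_bound hψ.aestronglyMeasurable K
    (ae_of_all _ fun t => by rw [Real.norm_of_nonneg (h0 t)]; exact hK t)
  have hint : Integrable ψ μ := hLp.integrable (by norm_num)
  let X : ι → ℝ → ℝ := fun j t => if j ∈ S then ψ t else 0
  have hX : ∀ j, MemLp (X j) 2 μ := by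
    intro j
    by_cases hj : j ∈ S <;> simp [X, hj, hLp]
  have hX' : ∀ j, MemLp (fun ω : ι → ℝ => X j (ω j)) 2 (Measure.pi fun _ => μ) := fun j =>
    (hX j).comp_measurePreserving (measurePreserving_eval (fun _ : ι => μ) j)
  have hsum : (∑ j, fun ω : ι → ℝ => X j (ω j)) = fun ω => ∑ j ∈ S, ψ (ω j) := by
    ext ω
    simp [X, Finset.sum_ite_mem]
  have hvarψ : Var[ψ; μ] ≤ K := by
    refine (variance_le_expectation_sq hψ.aestronglyMeasurable).trans ?_
    calc ∫ t, (ψ ^ 2) t ∂μ ≤ ∫ t, K * ψ t ∂μ := by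
          refine integral_mono hLp.integrable_sq (hint.const_mul K) fun t => ?_
          simp only [Pi.pow_apply, sq]
          exact mul_le_mul_of_nonneg_right (hK t) (h0 t)
      _ = K * ∫ t, ψ t ∂μ := integral_const_mul _ _
      _ ≤ K := by nlinarith
  have hvar : Var[fun ω : ι → ℝ => ∑ j ∈ S, ψ (ω j); Measure.pi fun _ => μ] ≤ #S * K := by
    rw [← hsum, variance_sum_pi hX]
    calc ∑ j, Var[X j; μ] = ∑ j ∈ S, Var[ψ; μ] := by
          rw [← Finset.sum_subset (Finset.subset_univ S)]
          · exact Finset.sum_congr rfl fun j hj => by simp [X, hj]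
          · intro j _ hj
            simp only [X, hj, if_false]
            exact variance_zero μ
      _ ≤ #S * K := by
          rw [Finset.sum_const, nsmul_eq_mul]
          gcongr
  have hmean : ∫ ω, ∑ j ∈ S, ψ (ω j) ∂(Measure.pi fun _ : ι => μ) = #S * ∫ t, ψ t ∂μ := by
    have hmp := fun j => measurePreserving_eval (fun _ : ι => μ) j
    rw [integral_finsetSum]
    · rw [Finset.sum_congr rfl (g := fun _ => ∫ t, ψ t ∂μ), Finset.sum_const, nsmul_eq_mul]
      intro j _
      have h := integral_map (μ := Measure.pi fun _ : ι => μ)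
        (hmp j).measurable.aemeasurable (f := ψ) hψ.aestronglyMeasurable
      rw [(hmp j).map_eq] at h
      exact h.symm
    · intro j _
      exact (hmp j).integrable_comp_of_integrable hint
  have hLpsum : MemLp (fun ω : ι → ℝ => ∑ j ∈ S, ψ (ω j)) 2 (Measure.pi fun _ => μ) := by
    rw [← hsum]
    exact memLp_finsetSum' _ fun j _ => hX' j
  refine (measure_mono ?_).trans ((meas_ge_le_variance_div_sq hLpsum hr).trans
    (ENNReal.ofReal_le_ofReal (by gcongr)))
  intro ω hω
  simp only [Set.mem_ofPred_eq, hmean] at hω ⊢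
  rw [abs_sub_comm]
  exact (by linarith : r ≤ _).trans (le_abs_self _)

/-- The likelihood ratio of `gaussianTilt`, set to zero where it exceeds `K`. -/
noncomputable def truncTilt (v : ℝ≥0) (u K t : ℝ) : ℝ :=
  if gaussianTilt v u t ≤ K then gaussianTilt v u t else 0

@[fun_prop]
lemma measurable_truncTilt (v : ℝ≥0) (u K : ℝ) : Measurable (truncTilt v u K) :=
  Measurable.ite (measurableSet_le (by fun_prop) measurable_const) (by fun_prop) measurable_const

lemma truncTilt_nonneg (v : ℝ≥0) (u K t : ℝ) : 0 ≤ truncTilt v u K t := by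
  unfold truncTilt
  split_ifs
  exacts [(gaussianTilt_pos _ _ _).le, le_rfl]

lemma truncTilt_le_gaussianTilt (v : ℝ≥0) (u K t : ℝ) :
    truncTilt v u K t ≤ gaussianTilt v u t := by
  unfold truncTilt
  split_ifs
  exacts [le_rfl, (gaussianTilt_pos _ _ _).le]

lemma truncTilt_le {K : ℝ} (hK : 0 ≤ K) (v : ℝ≥0) (u t : ℝ) : truncTilt v u K t ≤ K := by
  unfold truncTilt
  split_ifs
  exacts [by assumption, hK]

lemma lintegral_truncTilt {v : ℝ≥0} (hv : v ≠ 0) (u K : ℝ) :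
    ∫⁻ t, ENNReal.ofReal (truncTilt v u K t) ∂gaussianReal 0 v =
      gaussianReal 0 v {t | gaussianTilt v u (u + t) ≤ K} := by
  have hs : MeasurableSet {t | gaussianTilt v u t ≤ K} :=
    measurableSet_le (by fun_prop) measurable_const
  have hs' : MeasurableSet {t | gaussianTilt v u (u + t) ≤ K} :=
    measurableSet_le (by fun_prop) measurable_const
  have h := lintegral_const_add_gaussianReal hv u
    (f := {t | gaussianTilt v u t ≤ K}.indicator 1) (measurable_one.indicator hs)
  rw [← lintegral_indicator_one hs']
  refine Eq.trans ?_ h.symm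
  refine lintegral_congr fun t => ?_
  by_cases ht : gaussianTilt v u t ≤ K <;> simp [truncTilt, ht]

lemma lintegral_truncTilt_eq_ofReal {v : ℝ≥0} {K : ℝ} (hK : 0 ≤ K) (u : ℝ) :
    ∫⁻ t, ENNReal.ofReal (truncTilt v u K t) ∂gaussianReal 0 v =
      ENNReal.ofReal (∫ t, truncTilt v u K t ∂gaussianReal 0 v) := by
  rw [ofReal_integral_eq_lintegral_ofReal _ (ae_of_all _ (truncTilt_nonneg v u K))]
  exact Integrable.of_bound (by fun_prop) K (ae_of_all _ fun t => by
    rw [Real.norm_of_nonneg (truncTilt_nonneg _ _ _ _)]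
    exact truncTilt_le hK v u t)

lemma integral_truncTilt_le_one {v : ℝ≥0} (hv : v ≠ 0) {K : ℝ} (hK : 0 ≤ K) (u : ℝ) :
    ∫ t, truncTilt v u K t ∂gaussianReal 0 v ≤ 1 := by
  rw [← ENNReal.ofReal_le_one, ← lintegral_truncTilt_eq_ofReal hK, lintegral_truncTilt hv]
  exact prob_le_one

lemma le_integral_truncTilt {v : ℝ≥0} (hv : v ≠ 0) {K : ℝ} (hK : 0 < K) (u : ℝ) {r : ℝ}
    (hr : 0 < r) (hrK : r + u ^ 2 / 2 ≤ v * Real.log K) :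
    1 - u ^ 2 * v / r ^ 2 ≤ ∫ t, truncTilt v u K t ∂gaussianReal 0 v := by
  have hv0 : (0 : ℝ) < v := by exact_mod_cast pos_iff_ne_zero.mpr hv
  have hm0 : 0 ≤ ∫ t, truncTilt v u K t ∂gaussianReal 0 v :=
    integral_nonneg (truncTilt_nonneg v u K)
  have hLp : MemLp (fun t : ℝ => u * t) 2 (gaussianReal 0 v) :=
    (memLp_id_gaussianReal' 2 (by norm_num)).const_mul u
  have hcheb := meas_ge_le_variance_div_sq hLp hr
  rw [variance_const_mul, variance_fun_id_gaussianReal, integral_const_mul,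
    integral_id_gaussianReal, mul_zero] at hcheb
  have hs' : MeasurableSet {t | gaussianTilt v u (u + t) ≤ K} :=
    measurableSet_le (by fun_prop) measurable_const
  have hsub : {t | gaussianTilt v u (u + t) ≤ K}ᶜ ⊆ {t | r ≤ |u * t - 0|} := by
    intro t ht
    simp only [Set.mem_compl_iff, Set.mem_ofPred_eq, sub_zero] at ht ⊢
    by_contra! hlt
    apply ht
    rw [gaussianTilt, ← Real.le_log_iff_exp_le hK, div_le_iff₀ hv0]
    have := (abs_lt.mp hlt).2
    nlinarith
  have hcompl := (measure_mono hsub).trans hcheb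
  have htot := prob_add_prob_compl (μ := gaussianReal 0 v) hs'
  rw [← lintegral_truncTilt hv, lintegral_truncTilt_eq_ofReal hK.le] at htot
  have h1 : ENNReal.ofReal 1 ≤
      ENNReal.ofReal (∫ t, truncTilt v u K t ∂gaussianReal 0 v + u ^ 2 * v / r ^ 2) := by
    rw [ENNReal.ofReal_one, ENNReal.ofReal_add hm0 (by positivity), ← htot]
    gcongr
  rw [ENNReal.ofReal_le_ofReal_iff (by positivity)] at h1
  linarith

lemma lintegral_pi_mul_eval {ι : Type*} [Fintype ι] [DecidableEq ι] {μ : ι → Measure ℝ}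
    [∀ i, IsProbabilityMeasure (μ i)] {h : (ι → ℝ) → ℝ≥0∞} (hh : Measurable h) (i : ι)
    (hi : ∀ ω t, h (Function.update ω i t) = h ω) {φ : ℝ → ℝ≥0∞} (hφ : Measurable φ) :
    ∫⁻ ω, h ω * φ (ω i) ∂Measure.pi μ = (∫⁻ ω, h ω ∂Measure.pi μ) * ∫⁻ t, φ t ∂μ i := by
  rw [lintegral_pi_eq_lintegral_update (by fun_prop) i]
  simp only [hi, Function.update_self]
  simp_rw [lintegral_const_mul _ hφ]
  rw [lintegral_mul_const _ hh]

lemma mul_div_le_add_sq {t b b₀ K u g : ℝ} (ht : 0 ≤ t) (htK : t ≤ K) (hb₀ : 0 < b₀)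
    (hb : b₀ ≤ b) : b₀ / (K + b₀) * u ^ 2 * t ≤ t * (u - g) ^ 2 + b * g ^ 2 := by
  have h₁ : u ^ 2 * t * b₀ / (t + b₀) ≤ t * (u - g) ^ 2 + b₀ * g ^ 2 := by
    rw [div_le_iff₀ (by positivity)]
    nlinarith [sq_nonneg (t * (u - g) - b₀ * g)]
  have h₂ : b₀ / (K + b₀) * u ^ 2 * t ≤ u ^ 2 * t * b₀ / (t + b₀) := by
    rw [show b₀ / (K + b₀) * u ^ 2 * t = u ^ 2 * t * b₀ / (K + b₀) by ring]
    gcongr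
  nlinarith [mul_le_mul_of_nonneg_right hb (sq_nonneg g)]

/-- Lower bound on the error made at coordinate `i` by any estimator when the nonzero entry
`x i` may also have been located at one of the positions where `x` vanishes. -/
lemma le_lintegral_add_sum_swap {ι : Type*} [Fintype ι] [DecidableEq ι] {v : ℝ≥0} (hv : v ≠ 0)
    {x : ι → ℝ} {i : ι} (hxi : x i ≠ 0) {S : Finset ι} (hS : ∀ j, j ∈ S ↔ x j = 0)
    {g : (ι → ℝ) → ℝ} (hg : Measurable g) {k : ℕ} (hk : 0 < k) {K r b₀ p : ℝ} (hK : 0 < K)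
    (hr : 0 < r) (hb₀ : 0 < b₀) (hp0 : 0 ≤ p)
    (hp : p ≤ ∫ t, truncTilt v (x i) K t ∂gaussianReal 0 v) (hkb : k * b₀ ≤ #S * p - r) :
    ENNReal.ofReal (b₀ / (K + b₀) * (1 - #S * K / r ^ 2) * p * x i ^ 2) ≤
      ∫⁻ ω, ENNReal.ofReal ((x i - g (x + ω)) ^ 2) ∂Measure.pi (fun _ : ι => gaussianReal 0 v) +
        (k : ℝ≥0∞)⁻¹ * ∑ j ∈ S, ∫⁻ ω, ENNReal.ofReal (g (x ∘ Equiv.swap i j + ω) ^ 2)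
          ∂Measure.pi (fun _ : ι => gaussianReal 0 v) := by
  set Q := Measure.pi (fun _ : ι => gaussianReal 0 v) with hQ
  set u := x i with hu
  set m := ∫ t, truncTilt v u K t ∂gaussianReal 0 v with hm
  set z := Function.update x i 0 with hz
  have hiS : i ∉ S := fun h => hxi ((hS i).mp h)
  have hk' : (0 : ℝ) < k := by exact_mod_cast hk
  let G : Set (ι → ℝ) := {ω | ∑ j ∈ S, truncTilt v u K (ω j) ≤ #S * m - r}
  have hG : MeasurableSet G :=
    measurableSet_le (Finset.measurable_fun_sum _ fun j _ => by fun_prop) measurable_const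
  have hQG : ENNReal.ofReal (1 - #S * K / r ^ 2) ≤ Q Gᶜ := by
    rw [prob_compl_eq_one_sub hG, ENNReal.ofReal_sub _ (by positivity), ENNReal.ofReal_one]
    refine tsub_le_tsub_left ?_ 1
    exact measure_sum_pi_le (measurable_truncTilt v u K) (truncTilt_nonneg v u K)
      (truncTilt_le hK.le v u) (integral_truncTilt_le_one hv hK.le u) S hr
  have hshift : ∫⁻ ω, ENNReal.ofReal ((u - g (x + ω)) ^ 2) ∂Q =
      ∫⁻ ω, ENNReal.ofReal ((u - g (z + ω)) ^ 2) * ENNReal.ofReal (gaussianTilt v u (ω i)) ∂Q :=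
    lintegral_add_pi_gaussianReal hv x i (f := fun y => ENNReal.ofReal ((u - g y) ^ 2))
      (by fun_prop)
  have hshift' : ∀ j ∈ S, ∫⁻ ω, ENNReal.ofReal (g (x ∘ Equiv.swap i j + ω) ^ 2) ∂Q =
      ∫⁻ ω, ENNReal.ofReal (g (z + ω) ^ 2) * ENNReal.ofReal (gaussianTilt v u (ω j)) ∂Q := by
    intro j hj
    have hxj : x j = 0 := (hS j).mp hj
    have h := lintegral_add_pi_gaussianReal hv (x ∘ Equiv.swap i j) j
      (f := fun y => ENNReal.ofReal (g y ^ 2)) (by fun_prop)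
    have hupd : Function.update (x ∘ Equiv.swap i j) j 0 = z := by
      ext l
      rcases eq_or_ne l j with rfl | hlj
      · have : l ≠ i := fun h => hiS (h ▸ hj)
        simp [hz, this, hxj]
      · rcases eq_or_ne l i with rfl | hli
        · simp [hz, hlj, hxj]
        · simp [hz, hlj, hli, Equiv.swap_apply_of_ne_of_ne hli hlj]
    rw [hupd] at h
    simpa using h
  have hsum : (k : ℝ≥0∞)⁻¹ * ∑ j ∈ S, ∫⁻ ω, ENNReal.ofReal (g (x ∘ Equiv.swap i j + ω) ^ 2) ∂Q =
      ∫⁻ ω, (k : ℝ≥0∞)⁻¹ * ∑ j ∈ S,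
        ENNReal.ofReal (g (z + ω) ^ 2) * ENNReal.ofReal (gaussianTilt v u (ω j)) ∂Q := by
    rw [lintegral_const_mul _ (Finset.measurable_fun_sum _ fun j _ => by fun_prop),
      lintegral_finsetSum _ fun j _ => by fun_prop]
    congr 1
    exact Finset.sum_congr rfl hshift'
  rw [hshift, hsum, ← lintegral_add_left (by fun_prop)]
  have hupdG : ∀ ω t, Gᶜ.indicator (1 : (ι → ℝ) → ℝ≥0∞) (Function.update ω i t) =
      Gᶜ.indicator 1 ω := by
    intro ω t
    have : ∑ j ∈ S, truncTilt v u K (Function.update ω i t j) = ∑ j ∈ S, truncTilt v u K (ω j) :=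
      Finset.sum_congr rfl fun j hj => by
        rw [Function.update_of_ne (ne_of_mem_of_not_mem hj hiS)]
    simp only [Set.indicator, Set.mem_compl_iff, G, Set.mem_ofPred_eq, this, Pi.one_apply]
  calc ENNReal.ofReal (b₀ / (K + b₀) * (1 - #S * K / r ^ 2) * p * u ^ 2)
      = ENNReal.ofReal (b₀ / (K + b₀) * u ^ 2) *
          (ENNReal.ofReal (1 - #S * K / r ^ 2) * ENNReal.ofReal p) := by
        rw [← ENNReal.ofReal_mul' hp0, ← ENNReal.ofReal_mul (by positivity)]
        congr 1
        ring
    _ ≤ ENNReal.ofReal (b₀ / (K + b₀) * u ^ 2) *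
          (Q Gᶜ * ∫⁻ t, ENNReal.ofReal (truncTilt v u K t) ∂gaussianReal 0 v) := by
        rw [lintegral_truncTilt_eq_ofReal hK.le]
        gcongr
    _ = ∫⁻ ω, ENNReal.ofReal (b₀ / (K + b₀) * u ^ 2) *
          (Gᶜ.indicator 1 ω * ENNReal.ofReal (truncTilt v u K (ω i))) ∂Q := by
        have hind : Measurable (Gᶜ.indicator (1 : (ι → ℝ) → ℝ≥0∞)) :=
          measurable_one.indicator hG.compl
        rw [lintegral_const_mul _ (by fun_prop)]
        rw [lintegral_pi_mul_eval hind i hupdG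
          (φ := fun t => ENNReal.ofReal (truncTilt v u K t)) (by fun_prop),
          lintegral_indicator_one hG.compl]
    _ ≤ _ := by
        refine lintegral_mono fun ω => ?_
        by_cases hω : ω ∈ Gᶜ
        · have hb : b₀ ≤ (k : ℝ)⁻¹ * ∑ j ∈ S, gaussianTilt v u (ω j) := by
            rw [le_inv_mul_iff₀ hk']
            have h1 : #S * m - r < ∑ j ∈ S, truncTilt v u K (ω j) := by
              simpa [G] using hω
            have h2 : ∑ j ∈ S, truncTilt v u K (ω j) ≤ ∑ j ∈ S, gaussianTilt v u (ω j) :=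
              Finset.sum_le_sum fun j _ => truncTilt_le_gaussianTilt v u K (ω j)
            have h3 : (#S : ℝ) * p ≤ #S * m := by gcongr
            linarith
          have hk0 : (k : ℝ≥0∞)⁻¹ = ENNReal.ofReal (k : ℝ)⁻¹ := by
            rw [ENNReal.ofReal_inv_of_pos hk', ENNReal.ofReal_natCast]
          simp only [Set.indicator_of_mem hω, Pi.one_apply, one_mul]
          rw [← Finset.mul_sum, ← ENNReal.ofReal_sum_of_nonneg
              fun j _ => (gaussianTilt_pos v u (ω j)).le, hk0,
            ← ENNReal.ofReal_mul (sq_nonneg _), ← ENNReal.ofReal_mul (sq_nonneg _),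
            ← ENNReal.ofReal_mul (by positivity), ← ENNReal.ofReal_mul (by positivity),
            ← ENNReal.ofReal_add (mul_nonneg (sq_nonneg _) (gaussianTilt_pos _ _ _).le)]
          · refine ENNReal.ofReal_le_ofReal ?_
            have h := mul_div_le_add_sq (u := u) (g := g (z + ω))
              (truncTilt_nonneg v u K (ω i)) (truncTilt_le hK.le v u (ω i)) hb₀ hb
            have h' := mul_le_mul_of_nonneg_right (truncTilt_le_gaussianTilt v u K (ω i))
              (sq_nonneg (u - g (z + ω)))
            linarith
          · have := Finset.sum_nonneg fun j (_ : j ∈ S) => (gaussianTilt_pos v u (ω j)).le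
            positivity
        · simp [Set.indicator_of_notMem hω]

lemma mem_sparseVecs {U : Finset ℝ} {ι : Type} [Fintype ι] [DecidableEq ι] {w : ℕ} {x : ι → ℝ} :
    x ∈ sparseVecs U ι w ↔
      (∀ i, x i = 0 ∨ x i ∈ U) ∧ #{i | x i ≠ 0} = w := by
  simp [sparseVecs, Fintype.mem_piFinset]

lemma comp_equiv_mem_sparseVecs {U : Finset ℝ} {ι : Type} [Fintype ι] [DecidableEq ι] {w : ℕ}
    {x : ι → ℝ} (hx : x ∈ sparseVecs U ι w) (e : ι ≃ ι) : x ∘ e ∈ sparseVecs U ι w := by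
  rw [mem_sparseVecs] at hx ⊢
  refine ⟨fun i => hx.1 (e i), ?_⟩
  rw [← hx.2]
  exact Finset.card_equiv e (by simp)

lemma swap_comp_mem_sparseVecs {U : Finset ℝ} (hU0 : ∀ u ∈ U, u ≠ 0) {ι : Type} [Fintype ι]
    [DecidableEq ι] {w : ℕ} {a b : ℝ} (ha : a ∈ U) (hb : b ∈ U) {x : ι → ℝ}
    (hx : x ∈ sparseVecs U ι w) : Equiv.swap a b ∘ x ∈ sparseVecs U ι w := by
  rw [mem_sparseVecs] at hx ⊢
  have h0 : Equiv.swap a b 0 = 0 :=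
    Equiv.swap_apply_of_ne_of_ne (hU0 a ha).symm (hU0 b hb).symm
  have hiff (t : ℝ) : Equiv.swap a b t = 0 ↔ t = 0 := by
    rw [← (Equiv.swap a b).injective.eq_iff (a := t), h0]
  refine ⟨fun i => ?_, ?_⟩
  · rcases hx.1 i with h | h
    · exact Or.inl ((hiff _).mpr h)
    · right
      simp only [Function.comp_apply, Equiv.swap_apply_def]
      split_ifs <;> assumption
  · simpa only [Function.comp_apply, ne_eq, hiff] using hx.2

lemma sparseVecs_nonempty {U : Finset ℝ} (hU : U.Nonempty) (hU0 : ∀ u ∈ U, u ≠ 0) {ι : Type}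
    [Fintype ι] [DecidableEq ι] {w : ℕ} (hw : w ≤ Fintype.card ι) :
    (sparseVecs U ι w).Nonempty := by
  obtain ⟨u, hu⟩ := hU
  obtain ⟨T, -, hT⟩ := Finset.exists_subset_card_eq (s := (Finset.univ : Finset ι)) (n := w) hw
  refine ⟨fun i => if i ∈ T then u else 0, mem_sparseVecs.mpr ⟨fun i => ?_, ?_⟩⟩
  · by_cases h : i ∈ T <;> simp [h, hu]
  · rw [← hT]
    congr 1
    ext i
    by_cases h : i ∈ T <;> simp [h, hU0 u hu]

/-- Every value of `U` is taken equally often by the entries of the vectors in `sparseVecs`. -/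
lemma card_mul_sum_sum_sq_sparseVecs {U : Finset ℝ} (hU0 : ∀ u ∈ U, u ≠ 0) (ι : Type)
    [Fintype ι] [DecidableEq ι] (w : ℕ) :
    #U * ∑ x ∈ sparseVecs U ι w, ∑ i, x i ^ 2 = #(sparseVecs U ι w) * w * ∑ u ∈ U, u ^ 2 := by
  let c : ℝ → ℕ := fun u => ∑ x ∈ sparseVecs U ι w, #{i | x i = u}
  have hle : ∀ a ∈ U, ∀ b ∈ U, c a = c b := by
    intro a ha b hb
    refine Finset.sum_nbij' (fun x => Equiv.swap a b ∘ x) (fun x => Equiv.swap a b ∘ x)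
      (fun x hx => swap_comp_mem_sparseVecs hU0 ha hb hx)
      (fun x hx => swap_comp_mem_sparseVecs hU0 ha hb hx)
      (fun x _ => by ext i; simp) (fun x _ => by ext i; simp) fun x _ => ?_
    congr 1
    ext i
    simp [Equiv.swap_apply_eq_iff]
  have hsum (x : ι → ℝ) (hx : x ∈ sparseVecs U ι w) (φ : ℝ → ℝ) (hφ : φ 0 = 0) :
      ∑ i, φ (x i) = ∑ u ∈ U, #{i | x i = u} * φ u := by
    have hmem := (mem_sparseVecs.mp hx).1
    calc ∑ i, φ (x i) = ∑ i, ∑ u ∈ U, if x i = u then φ u else 0 := by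
          refine Finset.sum_congr rfl fun i _ => ?_
          rw [Finset.sum_ite_eq]
          split_ifs with h
          · rfl
          · rw [(hmem i).resolve_right h, hφ]
      _ = ∑ u ∈ U, #{i | x i = u} * φ u := by
          rw [Finset.sum_comm]
          refine Finset.sum_congr rfl fun u _ => ?_
          rw [← Finset.sum_filter, Finset.sum_const, nsmul_eq_mul]
  have hsum' (φ : ℝ → ℝ) (hφ : φ 0 = 0) :
      ∑ x ∈ sparseVecs U ι w, ∑ i, φ (x i) = ∑ u ∈ U, c u * φ u := by
    rw [Finset.sum_congr rfl fun x hx => hsum x hx φ hφ, Finset.sum_comm]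
    refine Finset.sum_congr rfl fun u _ => ?_
    rw [← Finset.sum_mul]
    push_cast [c]
    rfl
  have hcount : ∑ u ∈ U, (c u : ℝ) = #(sparseVecs U ι w) * w := by
    have h := hsum' (fun t => if t = 0 then 0 else 1) (by simp)
    rw [Finset.sum_congr rfl (g := fun _ => (w : ℝ)), Finset.sum_const, nsmul_eq_mul] at h
    · rw [h]
      exact Finset.sum_congr rfl fun u hu => by simp [hU0 u hu]
    · intro x hx
      rw [← (mem_sparseVecs.mp hx).2, Finset.card_filter]
      push_cast
      exact Finset.sum_congr rfl fun i _ => by by_cases h : x i = 0 <;> simp [h]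
  rw [hsum' (fun t => t ^ 2) (by simp), ← hcount, Finset.sum_mul_sum, ← nsmul_eq_mul,
    ← Finset.sum_const]
  refine Finset.sum_congr rfl fun a ha => ?_
  refine Finset.sum_congr rfl fun b hb => ?_
  rw [hle a ha b hb]

/-- Contributions of vanishing entries can be redistributed to the nonzero entries by exchanging
the two positions. -/
lemma sum_sum_eq_zero_sparseVecs (U : Finset ℝ) {ι : Type} [Fintype ι] [DecidableEq ι] {w : ℕ}
    (hw : 0 < w) (F : (ι → ℝ) → ι → ℝ≥0∞) :
    ∑ x ∈ sparseVecs U ι w, ∑ i with x i = 0, F x i =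
      ∑ x ∈ sparseVecs U ι w, ∑ i with x i ≠ 0,
        (w : ℝ≥0∞)⁻¹ * ∑ j with x j = 0, F (x ∘ Equiv.swap i j) i := by
  have hw0 : (w : ℝ≥0∞) ≠ 0 := by exact_mod_cast hw.ne'
  have hswap (i j : ι) :
      ∑ x ∈ sparseVecs U ι w, (if x i = 0 ∧ x j ≠ 0 then F x i else 0) =
        ∑ x ∈ sparseVecs U ι w,
          if x i ≠ 0 ∧ x j = 0 then F (x ∘ Equiv.swap i j) i else 0 := by
    refine Finset.sum_nbij' (fun x => x ∘ Equiv.swap i j) (fun x => x ∘ Equiv.swap i j)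
      (fun x hx => comp_equiv_mem_sparseVecs hx _) (fun x hx => comp_equiv_mem_sparseVecs hx _)
      (fun x _ => by ext; simp) (fun x _ => by ext; simp) fun x _ => ?_
    have : (x ∘ Equiv.swap i j) ∘ Equiv.swap i j = x := by ext; simp
    simp [this, and_comm]
  calc ∑ x ∈ sparseVecs U ι w, ∑ i with x i = 0, F x i
      = ∑ x ∈ sparseVecs U ι w, (w : ℝ≥0∞)⁻¹ *
          ∑ i, ∑ j, if x i = 0 ∧ x j ≠ 0 then F x i else 0 := by
        refine Finset.sum_congr rfl fun x hx => ?_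
        have h (i : ι) : (∑ j, if x i = 0 ∧ x j ≠ 0 then F x i else 0) =
            w * if x i = 0 then F x i else 0 := by
          by_cases hi : x i = 0
          · simp only [hi, true_and, if_true]
            rw [← Finset.sum_filter, Finset.sum_const, (mem_sparseVecs.mp hx).2, nsmul_eq_mul]
          · simp [hi]
        simp_rw [h]
        rw [← Finset.mul_sum, ← mul_assoc,
          ENNReal.inv_mul_cancel hw0 (ENNReal.natCast_ne_top w), one_mul, Finset.sum_filter]
    _ = (w : ℝ≥0∞)⁻¹ * ∑ i, ∑ j, ∑ x ∈ sparseVecs U ι w,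
          if x i = 0 ∧ x j ≠ 0 then F x i else 0 := by
        rw [← Finset.mul_sum, Finset.sum_comm]
        simp_rw [Finset.sum_comm (s := sparseVecs U ι w)]
    _ = (w : ℝ≥0∞)⁻¹ * ∑ i, ∑ j, ∑ x ∈ sparseVecs U ι w,
          if x i ≠ 0 ∧ x j = 0 then F (x ∘ Equiv.swap i j) i else 0 := by
        simp_rw [hswap]
    _ = ∑ x ∈ sparseVecs U ι w, (w : ℝ≥0∞)⁻¹ *
          ∑ i, ∑ j, if x i ≠ 0 ∧ x j = 0 then F (x ∘ Equiv.swap i j) i else 0 := by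
        rw [← Finset.mul_sum, Finset.sum_comm (s := sparseVecs U ι w)]
        simp_rw [Finset.sum_comm (s := sparseVecs U ι w)]
    _ = _ := by
        refine Finset.sum_congr rfl fun x _ => ?_
        rw [← Finset.mul_sum, Finset.sum_filter]
        congr 1
        refine Finset.sum_congr rfl fun i _ => ?_
        by_cases hi : x i = 0
        · simp [hi]
        · simp [hi, Finset.sum_filter]

lemma lintegral_uniformOn_prod {α β : Type*} [MeasurableSpace α] [MeasurableSingletonClass α]
    [MeasurableSpace β] (X : Finset α) (μ : Measure β) [SFinite μ] {f : α × β → ℝ≥0∞}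
    (hf : Measurable f) :
    ∫⁻ p, f p ∂(uniformOn X).prod μ = (#X : ℝ≥0∞)⁻¹ * ∑ x ∈ X, ∫⁻ ω, f (x, ω) ∂μ := by
  rw [lintegral_prod _ hf.aemeasurable, _root_.uniformOn, lintegral_smul_measure,
    lintegral_finsetSum_measure]
  simp

/-- Non-asymptotic lower bound on the risk of an arbitrary estimator. -/
lemma le_lintegral_risk {U : Finset ℝ} (hU : U.Nonempty) (hU0 : ∀ u ∈ U, u ≠ 0) {ι : Type}
    [Fintype ι] [DecidableEq ι] {v : ℝ≥0} (hv : v ≠ 0) {w : ℕ} (hw : 0 < w)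
    (hwι : w ≤ Fintype.card ι) {xhat : (ι → ℝ) → (ι → ℝ)} (hmeas : Measurable xhat)
    {K r b₀ p : ℝ} (hK : 0 < K) (hr : 0 < r) (hb₀ : 0 < b₀) (hp0 : 0 ≤ p)
    (hp : ∀ u ∈ U, p ≤ ∫ t, truncTilt v u K t ∂gaussianReal 0 v)
    (hkb : w * b₀ ≤ (Fintype.card ι - w) * p - r) :
    ENNReal.ofReal (b₀ / (K + b₀) * (1 - (Fintype.card ι - w) * K / r ^ 2) * p) *
        ENNReal.ofReal ((∑ u ∈ U, u ^ 2) / #U) ≤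
      (w : ℝ≥0∞)⁻¹ * ∫⁻ q : (ι → ℝ) × (ι → ℝ),
        ENNReal.ofReal (∑ i, (q.1 i - xhat (q.1 + q.2) i) ^ 2)
          ∂((uniformOn (sparseVecs U ι w)).prod (Measure.pi fun _ : ι => gaussianReal 0 v)) := by
  set c := b₀ / (K + b₀) * (1 - (Fintype.card ι - w) * K / r ^ 2) * p
  set X := sparseVecs U ι w with hX
  let A : (ι → ℝ) → ι → ℝ≥0∞ := fun x i =>
    ∫⁻ ω, ENNReal.ofReal ((x i - xhat (x + ω) i) ^ 2) ∂Measure.pi fun _ : ι => gaussianReal 0 v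
  have hmeas' (i : ι) : Measurable fun y => xhat y i := (measurable_pi_apply i).comp hmeas
  have hrisk : ∑ x ∈ X, ∫⁻ ω, ENNReal.ofReal (∑ i, (x i - xhat (x + ω) i) ^ 2)
      ∂Measure.pi (fun _ : ι => gaussianReal 0 v) = ∑ x ∈ X, ∑ i, A x i := by
    refine Finset.sum_congr rfl fun x _ => ?_
    simp_rw [ENNReal.ofReal_sum_of_nonneg fun i _ => sq_nonneg _]
    exact lintegral_finsetSum _ fun i _ => by fun_prop
  have hcoord (x : ι → ℝ) (hx : x ∈ X) (i : ι) (hi : x i ≠ 0) :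
      ENNReal.ofReal (c * x i ^ 2) ≤
        A x i + (w : ℝ≥0∞)⁻¹ * ∑ j with x j = 0, A (x ∘ Equiv.swap i j) i := by
    rw [hX, mem_sparseVecs] at hx
    have hcard : (#{j | x j = 0} : ℝ) = Fintype.card ι - w := by
      rw [← hx.2, eq_sub_iff_add_eq, ← Finset.card_univ]
      exact_mod_cast Finset.card_filter_add_card_filter_not (s := Finset.univ) (fun j => x j = 0)
    have h := le_lintegral_add_sum_swap hv hi (S := {j | x j = 0}) (by simp) (hmeas' i) hw hK hr
      hb₀ hp0 (hp _ ((hx.1 i).resolve_left hi)) (by rwa [hcard])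
    rw [hcard] at h
    refine h.trans_eq ?_
    congr 2
    refine Finset.sum_congr rfl fun j hj => ?_
    have hj0 : x j = 0 := by simpa using hj
    simp [A, hj0]
  have hsum : ENNReal.ofReal (c * ∑ x ∈ X, ∑ i, x i ^ 2) ≤ ∑ x ∈ X, ∑ i, A x i := by
    calc ENNReal.ofReal (c * ∑ x ∈ X, ∑ i, x i ^ 2)
        = ∑ x ∈ X, ∑ i with x i ≠ 0, ENNReal.ofReal (c * x i ^ 2) := by
          have h (x : ι → ℝ) : ∑ i, x i ^ 2 = ∑ i with x i ≠ 0, x i ^ 2 := by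
            symm
            refine Finset.sum_subset (Finset.subset_univ _) fun i _ hi => ?_
            simpa using hi
          simp_rw [h, ENNReal.ofReal_mul' (sq_nonneg _), ← Finset.mul_sum]
          rw [ENNReal.ofReal_mul' (by positivity), ENNReal.ofReal_sum_of_nonneg
            fun x _ => Finset.sum_nonneg fun i _ => sq_nonneg _]
          simp_rw [ENNReal.ofReal_sum_of_nonneg fun i _ => sq_nonneg _]
      _ ≤ ∑ x ∈ X, ∑ i with x i ≠ 0,
            (A x i + (w : ℝ≥0∞)⁻¹ * ∑ j with x j = 0, A (x ∘ Equiv.swap i j) i) :=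
          Finset.sum_le_sum fun x hx => Finset.sum_le_sum fun i hi =>
            hcoord x hx i (by simpa using hi)
      _ = ∑ x ∈ X, ∑ i, A x i := by
          simp_rw [Finset.sum_add_distrib]
          rw [hX, ← sum_sum_eq_zero_sparseVecs U hw A, ← Finset.sum_add_distrib]
          refine Finset.sum_congr rfl fun x _ => ?_
          rw [add_comm]
          exact Finset.sum_filter_add_sum_filter_not _ _ _
  clear_value c
  have hcX : (0 : ℝ) < #X := by exact_mod_cast (sparseVecs_nonempty hU hU0 hwι).card_pos
  have hcU : (0 : ℝ) < #U := by exact_mod_cast hU.card_pos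
  have hw' : (0 : ℝ) < w := by exact_mod_cast hw
  have hval : (∑ u ∈ U, u ^ 2) / #U = (w : ℝ)⁻¹ * ((#X : ℝ)⁻¹ * ∑ x ∈ X, ∑ i, x i ^ 2) := by
    have h := card_mul_sum_sum_sq_sparseVecs hU0 ι w
    rw [← hX] at h
    field_simp
    linarith
  rw [lintegral_uniformOn_prod _ _ (by fun_prop)]
  simp only
  rw [hrisk, hval]
  calc _ = (w : ℝ≥0∞)⁻¹ * ((#X : ℝ≥0∞)⁻¹ * ENNReal.ofReal (c * ∑ x ∈ X, ∑ i, x i ^ 2)) := by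
        rw [ENNReal.ofReal_mul' (p := c) (by positivity), ENNReal.ofReal_mul (by positivity),
          ENNReal.ofReal_mul (by positivity), ENNReal.ofReal_inv_of_pos hw',
          ENNReal.ofReal_inv_of_pos hcX, ENNReal.ofReal_natCast, ENNReal.ofReal_natCast]
        ring
    _ ≤ _ := by gcongr

lemma tendsto_log_div_atTop {k N : ℕ → ℕ} {γ : ℝ} (hγ1 : γ < 1) (hk : Tendsto k atTop atTop)
    (hkN : ∀ n, k n < N n)
    (hγ : Tendsto (fun n => Real.log (k n) / Real.log (N n)) atTop (nhds γ)) :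
    Tendsto (fun n => Real.log ((N n : ℝ) / (k n : ℝ))) atTop atTop := by
  have hN : Tendsto (fun n => Real.log (N n)) atTop atTop :=
    Real.tendsto_log_atTop.comp (tendsto_natCast_atTop_atTop.comp
      (tendsto_atTop_mono (fun n => (hkN n).le) hk))
  refine (hN.atTop_mul_pos (sub_pos.mpr hγ1) (hγ.const_sub 1)).congr' ?_
  filter_upwards [hk.eventually_gt_atTop 0, hN.eventually_gt_atTop 0] with n hn hlog
  have h1 : (k n : ℝ) ≠ 0 := by exact_mod_cast hn.ne'
  have h2 : (N n : ℝ) ≠ 0 := by exact_mod_cast (hn.trans (hkN n)).ne'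
  rw [Real.log_div h2 h1]
  field_simp

theorem converse_lower_bound
    (U : Finset ℝ) (hU : U.Nonempty) (hU0 : ∀ u ∈ U, u ≠ 0)
    (umin umax : ℝ) (humin : IsLeast {t : ℝ | ∃ u ∈ U, t = |u|} umin)
    (humax : IsGreatest {t : ℝ | ∃ u ∈ U, t = |u|} umax)
    (σ2 : ℝ) (hσ : umax ^ 2 / 2 < σ2)
    (C0 C1 : ℝ)
    (hC0 : C0 = σ2 / umax ^ 2 * (1 - umax ^ 2 / (2 * σ2)))
    (hC1 : C1 = σ2 / (2 * umax ^ 2) * (1 - umax ^ 2 / (2 * σ2)) ^ 2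
      + (umax - umin / 2) ^ 2 / (2 * σ2))
    (γ : ℝ) (hγ0 : 0 ≤ γ) (hγ1 : γ < 1)
    (hγlt : γ < min (min (C0 / (C0 + σ2 / (umax * umin))) (C1 / (C1 + 3))) (1 / 2))
    (k N : ℕ → ℕ) (hk : Tendsto k atTop atTop) (hkN : ∀ n, k n < N n)
    (hγ : Tendsto (fun n => Real.log (k n) / Real.log (N n)) atTop (nhds γ))
    (xhat : (n : ℕ) → (Fin (N n) → ℝ) → (Fin (N n) → ℝ))
    (hmeas : ∀ n, Measurable (xhat n)) :
    ENNReal.ofReal ((∑ u ∈ U, u ^ 2) / U.card) ≤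
      Filter.liminf (fun n =>
        (k n : ℝ≥0∞)⁻¹ *
          ∫⁻ p : (Fin (N n) → ℝ) × (Fin (N n) → ℝ),
            ENNReal.ofReal (∑ i, (p.1 i - xhat n (p.1 + p.2) i) ^ 2)
            ∂((uniformOn (sparseVecs U (Fin (N n)) (k n))).prod
              (Measure.pi fun _ : Fin (N n) =>
                gaussianReal 0 (σ2 / Real.log ((N n : ℝ) / (k n : ℝ))).toNNReal)))
        atTop := by
  obtain ⟨u₀, hu₀U, hu₀⟩ := humax.1
  have humax0 : 0 < umax := hu₀ ▸ abs_pos.mpr (hU0 u₀ hu₀U)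
  have hUle : ∀ u ∈ U, u ^ 2 ≤ umax ^ 2 := fun u hu => by
    rw [← sq_abs u]
    exact pow_le_pow_left₀ (abs_nonneg u) (humax.2 ⟨u, hu, rfl⟩) 2
  have hσ0 : 0 < σ2 := lt_of_le_of_lt (by positivity) hσ
  obtain ⟨r₀, hr₀, hr₀σ⟩ : ∃ r₀ : ℝ, 0 < r₀ ∧ umax ^ 2 / 2 + 2 * r₀ = σ2 :=
    ⟨(σ2 - umax ^ 2 / 2) / 2, by linarith, by ring⟩
  have hL := tendsto_log_div_atTop hγ1 hk hkN hγ
  have hkpos : ∀ᶠ n in atTop, 0 < k n := hk.eventually_gt_atTop 0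
  have hkinv : Tendsto (fun n => (k n : ℝ)⁻¹) atTop (nhds 0) :=
    (tendsto_natCast_atTop_atTop.comp hk).inv_tendsto_atTop
  set L : ℕ → ℝ := fun n => Real.log ((N n : ℝ) / (k n : ℝ)) with hLdef
  have hLinv : Tendsto (fun n => (L n)⁻¹) atTop (nhds 0) := hL.inv_tendsto_atTop
  have hlogL : Tendsto (fun n => Real.log (L n) / L n) atTop (nhds 0) :=
    Real.isLittleO_log_id_atTop.tendsto_div_nhds_zero.comp hL
  have hratio : Tendsto (fun n => (k n : ℝ) / N n) atTop (nhds 0) := by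
    refine (Real.tendsto_exp_neg_atTop_nhds_zero.comp hL).congr' ?_
    filter_upwards [hkpos] with n hn
    have h1 : (0 : ℝ) < k n := by exact_mod_cast hn
    have h2 : (0 : ℝ) < N n := by exact_mod_cast hn.trans (hkN n)
    simp only [Function.comp_apply, hLdef]
    rw [Real.exp_neg, Real.exp_log (by positivity), inv_div]
  let p : ℕ → ℝ := fun n => 1 - umax ^ 2 * (σ2 * (L n)⁻¹) / r₀ ^ 2
  have hp : Tendsto p atTop (nhds 1) := by
    have h := ((hLinv.const_mul σ2).const_mul (umax ^ 2)).div_const (r₀ ^ 2)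
    simpa [p] using h.const_sub 1
  have hNkp : Tendsto (fun n => (1 - (k n : ℝ) / N n) * p n) atTop (nhds 1) := by
    simpa using (hratio.const_sub 1).mul hp
  let c : ℕ → ℝ := fun n => (1 / 2) / ((L n)⁻¹ + 1 / 2) *
    (1 - (1 - (k n : ℝ) / N n) * (16 * (k n : ℝ)⁻¹ * (L n)⁻¹)) * p n
  have hc : Tendsto c atTop (nhds 1) := by
    have h1 : Tendsto (fun n => (1 / 2) / ((L n)⁻¹ + 1 / 2)) atTop
        (nhds ((1 / 2) / (0 + 1 / 2))) :=
      tendsto_const_nhds.div (hLinv.add_const _) (by norm_num)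
    have h2 := ((hratio.const_sub 1).mul ((hkinv.const_mul 16).mul hLinv)).const_sub 1
    simpa [c] using (h1.mul h2).mul hp
  refine ENNReal.le_of_forall_lt_one_mul_le fun a ha => le_liminf_of_le (h := ?_)
  have hca : ∀ᶠ n in atTop, a < ENNReal.ofReal (c n) := by
    have h := ENNReal.tendsto_ofReal hc
    rw [ENNReal.ofReal_one] at h
    exact h.eventually_const_lt ha
  filter_upwards [hca, hkpos, hL.eventually_gt_atTop 0, hp.eventually_const_lt one_pos,
    hNkp.eventually_const_lt (by norm_num : (3 / 4 : ℝ) < 1),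
    (hlogL.const_mul σ2).eventually_lt_const (by simpa using hr₀ : σ2 * 0 < r₀)]
    with n hcn hkn hLn hpn hNkn hlogn
  have hk0 : (0 : ℝ) < k n := by exact_mod_cast hkn
  have hN0 : (0 : ℝ) < N n := by exact_mod_cast hkn.trans (hkN n)
  have hv0 : 0 < σ2 / L n := by positivity
  have hv : (σ2 / L n).toNNReal ≠ 0 := (Real.toNNReal_pos.mpr hv0).ne'
  have hvr : ((σ2 / L n).toNNReal : ℝ) = σ2 / L n := Real.coe_toNNReal _ hv0.le
  have hpu : ∀ u ∈ U, p n ≤ ∫ t, truncTilt (σ2 / L n).toNNReal u ((N n : ℝ) / k n / L n) t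
      ∂gaussianReal 0 (σ2 / L n).toNNReal := by
    intro u hu
    have h := le_integral_truncTilt hv (K := (N n : ℝ) / k n / L n) (by positivity) u hr₀ (by
      rw [hvr, Real.log_div (by positivity) hLn.ne']
      change r₀ + u ^ 2 / 2 ≤ σ2 / L n * (L n - Real.log (L n))
      have e : σ2 / L n * (L n - Real.log (L n)) = σ2 - σ2 * (Real.log (L n) / L n) := by
        field_simp
      rw [e]
      linarith [hUle u hu])
    refine le_trans ?_ h
    rw [hvr, div_eq_mul_inv σ2]
    simp only [p]
    gcongr 1 - ?_ * _ / _
    exact hUle u hu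
  have hrisk := le_lintegral_risk hU hU0 hv hkn (by simpa using (hkN n).le) (hmeas n)
    (K := (N n : ℝ) / k n / L n) (r := N n / 4) (b₀ := N n / (2 * k n)) (p := p n)
    (by positivity) (by positivity) (by positivity) hpn.le hpu (by
      rw [Fintype.card_fin]
      have e1 : (k n : ℝ) * (N n / (2 * k n)) = N n / 2 := by field_simp
      have e2 : ((N n : ℝ) - k n) * p n = N n * ((1 - (k n : ℝ) / N n) * p n) := by field_simp
      rw [e1, e2]
      nlinarith)
  refine le_trans ?_ hrisk
  gcongr
  refine hcn.le.trans_eq ?_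
  congr 1
  simp only [c, Fintype.card_fin]
  field_simp
  ring
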